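/- Let μ = ∑_{n∈ℤ} a_n δ_n be a probability distribution concentrated on ℤ. Then μ is quasi-infinitely divisible if and only if μ̂(z) ≠ 0 for all z ∈ ℝ. In that case the Gaussian variance of μ is 0, the quasi-Lévy measure ν is a finite signed measure concentrated on ℤ∖{0}, and the drift is an integer k = (2πi)^{-1} g(2π) where g is the distinguished logarithm of μ̂; moreover ν({n}) equals the n-th Fourier coefficient of the 2π-periodic function g(z) - ikz. -/

import Mathlib

open MeasureTheory Complex Filter

noncomputable section

/-- Characteristic function of a measure on ℝ. -/
def charFn (μ : Measure ℝ) (z : ℝ) : ℂ := ∫ x, Complex.exp (Complex.I * z * x) ∂μ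

/-- A representation function: bounded, Borel measurable, with (c x - x)/x² → 0 as x → 0. -/
def IsRepFn (c : ℝ → ℝ) : Prop :=
  Measurable c ∧ (∃ M : ℝ, ∀ x, |c x| ≤ M) ∧
    Tendsto (fun x => (c x - x) / x ^ 2) (nhdsWithin 0 {(0:ℝ)}ᶜ) (nhds 0)

/-- The kernel g_c(x,z). -/
def gKer (c : ℝ → ℝ) (x z : ℝ) : ℂ :=
  if x = 0 then -(z:ℂ)^2 / 2
  else (Complex.exp (Complex.I * z * x) - 1 - Complex.I * z * c x) / ((min 1 (x^2) : ℝ) : ℂ)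

/-- Quasi-infinitely divisible w.r.t. c: the characteristic function has a
Lévy–Khintchine type representation with a finite signed measure ζ = ζp - ζm
(given by its Jordan decomposition). -/
def IsQID (c : ℝ → ℝ) (μ : Measure ℝ) : Prop :=
  ∃ γ : ℝ, ∃ ζp ζm : Measure ℝ, IsFiniteMeasure ζp ∧ IsFiniteMeasure ζm ∧
    Measure.MutuallySingular ζp ζm ∧
    ∀ z : ℝ, charFn μ z =
      Complex.exp (Complex.I * γ * z + (∫ x, gKer c x z ∂ζp) - ∫ x, gKer c x z ∂ζm)

/-- Infinitely divisible w.r.t. c: as above with a (positive) finite measure ζ. -/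
def IsID (c : ℝ → ℝ) (μ : Measure ℝ) : Prop :=
  ∃ γ : ℝ, ∃ ζ : Measure ℝ, IsFiniteMeasure ζ ∧
    ∀ z : ℝ, charFn μ z = Complex.exp (Complex.I * γ * z + ∫ x, gKer c x z ∂ζ)

/-- The Lévy–Khintchine integral ∫ (e^{izx} - 1 - izc(x)) dν. -/
def lkInt (c : ℝ → ℝ) (ν : Measure ℝ) (z : ℝ) : ℂ :=
  ∫ x, (Complex.exp (Complex.I * z * x) - 1 - Complex.I * z * c x) ∂ν

/-- μ has characteristic triplet (a, ν, γ) w.r.t. c, where the quasi-Lévy measure ν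
is given by its Jordan decomposition ν = νp - νm. -/
def HasTriplet (c : ℝ → ℝ) (μ : Measure ℝ) (a : ℝ) (νp νm : Measure ℝ) (γ : ℝ) : Prop :=
  Measure.MutuallySingular νp νm ∧ νp {0} = 0 ∧ νm {0} = 0 ∧
  (∫⁻ x, ENNReal.ofReal (min 1 (x^2)) ∂(νp + νm)) < ⊤ ∧
  ∀ z : ℝ, charFn μ z =
    Complex.exp (Complex.I * γ * z - a * z^2 / 2 + lkInt c νp z - lkInt c νm z)

section WienerAlgebra

variable {T : ℝ}

/-- Trigonometric polynomials of degree at most `N`. -/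
def trigPoly (T : ℝ) (N : ℕ) : Submodule ℂ C(AddCircle T, ℂ) :=
  Submodule.span ℂ (fourier '' Set.Icc (-N : ℤ) N)

lemma fourier_mem_trigPoly {n : ℤ} {N : ℕ} (h : n ∈ Set.Icc (-N : ℤ) N) :
    fourier n ∈ trigPoly T N :=
  Submodule.subset_span ⟨n, h, rfl⟩

lemma mul_mem_trigPoly {M N : ℕ} {p q : C(AddCircle T, ℂ)} (hp : p ∈ trigPoly T M)
    (hq : q ∈ trigPoly T N) : p * q ∈ trigPoly T (M + N) := by
  have h := Submodule.mul_mem_mul hp hq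
  rw [trigPoly, trigPoly, Submodule.span_mul_span] at h
  refine Submodule.span_mono ?_ h
  rintro _ ⟨_, ⟨m, hm, rfl⟩, _, ⟨n, hn, rfl⟩, rfl⟩
  refine ⟨m + n, ?_, ?_⟩
  · simp only [Set.mem_Icc, Nat.cast_add] at *
    omega
  · ext x
    exact fourier_add

lemma pow_mem_trigPoly {N : ℕ} {q : C(AddCircle T, ℂ)} (hq : q ∈ trigPoly T N) (j : ℕ) :
    q ^ j ∈ trigPoly T (j * N) := by
  induction j with
  | zero =>
    have : (q ^ 0) = fourier 0 := by ext x; simp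
    rw [this]
    exact fourier_mem_trigPoly (by simp)
  | succ j ih =>
    rw [pow_succ, Nat.succ_mul]
    exact mul_mem_trigPoly ih hq

variable [Fact (0 < T)]

lemma norm_fourierCoeff_le (n : ℤ) (f : C(AddCircle T, ℂ)) : ‖fourierCoeff f n‖ ≤ ‖f‖ := by
  refine (norm_integral_le_of_norm_le_const (C := ‖f‖) (Eventually.of_forall fun x => ?_)).trans ?_
  · rw [norm_smul, fourier_apply, Circle.norm_coe, one_mul]
    exact f.norm_coe_le_norm x
  · simp

lemma enorm_fourierCoeff_le (n : ℤ) (f : C(AddCircle T, ℂ)) : ‖fourierCoeff f n‖ₑ ≤ ‖f‖ₑ := by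
  rw [← ofReal_norm, ← ofReal_norm]
  exact ENNReal.ofReal_le_ofReal (norm_fourierCoeff_le n f)

/-- The `n`-th Fourier coefficient as a bounded linear functional on continuous functions. -/
def fourierCoeffCLM (n : ℤ) : C(AddCircle T, ℂ) →L[ℂ] ℂ :=
  LinearMap.mkContinuous
    { toFun := fun f => fourierCoeff f n
      map_add' := fun f g => congrFun (fourierCoeff.add
        (f.continuous.integrable_of_hasCompactSupport (HasCompactSupport.of_compactSpace _))
        (g.continuous.integrable_of_hasCompactSupport (HasCompactSupport.of_compactSpace _))) n
      map_smul' := fun c f => fourierCoeff.const_smul f c n } 1 fun f => by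
    rw [one_mul]
    exact norm_fourierCoeff_le n f

@[simp]
lemma fourierCoeffCLM_apply (n : ℤ) (f : C(AddCircle T, ℂ)) :
    fourierCoeffCLM n f = fourierCoeff f n := rfl

/-- The Wiener algebra norm: the sum of the absolute values of the Fourier coefficients. -/
def wienerNorm (f : C(AddCircle T, ℂ)) : ENNReal := ∑' n : ℤ, ‖fourierCoeff f n‖ₑ

lemma summable_fourierCoeff {f : C(AddCircle T, ℂ)} (hf : wienerNorm f ≠ ⊤) :
    Summable (fourierCoeff f) :=
  .of_enorm hf

lemma wienerNorm_add_le (f g : C(AddCircle T, ℂ)) :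
    wienerNorm (f + g) ≤ wienerNorm f + wienerNorm g := by
  rw [wienerNorm, wienerNorm, wienerNorm, ← ENNReal.tsum_add]
  refine ENNReal.tsum_le_tsum fun n => ?_
  rw [← fourierCoeffCLM_apply, map_add]
  exact enorm_add_le _ _

lemma wienerNorm_smul (c : ℂ) (f : C(AddCircle T, ℂ)) :
    wienerNorm (c • f) = ‖c‖ₑ * wienerNorm f := by
  rw [wienerNorm, wienerNorm, ← ENNReal.tsum_mul_left]
  refine tsum_congr fun n => ?_
  rw [← fourierCoeffCLM_apply, map_smul, smul_eq_mul, enorm_mul, fourierCoeffCLM_apply]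

lemma wienerNorm_le_tsum {ι : Type*} {f : ι → C(AddCircle T, ℂ)} {F : C(AddCircle T, ℂ)}
    (h : HasSum f F) : wienerNorm F ≤ ∑' i, wienerNorm (f i) := by
  simp only [wienerNorm]
  rw [ENNReal.tsum_comm]
  refine ENNReal.tsum_le_tsum fun n => ?_
  have hn := h.mapL (fourierCoeffCLM n)
  rw [← fourierCoeffCLM_apply, ← hn.tsum_eq]
  exact enorm_tsum_le_tsum_enorm

lemma fourierCoeff_fourier_mul (k n : ℤ) (f : C(AddCircle T, ℂ)) :
    fourierCoeff (fourier k * f : C(AddCircle T, ℂ)) n = fourierCoeff f (n - k) := by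
  refine integral_congr_ae (Eventually.of_forall fun x => ?_)
  simp only [ContinuousMap.mul_apply, smul_eq_mul, ← mul_assoc]
  rw [← fourier_add]
  congr 3
  ring

lemma wienerNorm_fourier_mul (k : ℤ) (f : C(AddCircle T, ℂ)) :
    wienerNorm (fourier k * f) = wienerNorm f := by
  simp only [wienerNorm, fourierCoeff_fourier_mul]
  exact (Equiv.subRight k).tsum_eq fun n => ‖fourierCoeff f n‖ₑ

lemma fourierCoeff_fourier_eq (k n : ℤ) :
    fourierCoeff (fourier k : C(AddCircle T, ℂ)) n = if n = k then 1 else 0 := by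
  rw [fourierCoeff_fourier, Pi.single_apply]

lemma wienerNorm_fourier (k : ℤ) : wienerNorm (fourier k : C(AddCircle T, ℂ)) = 1 := by
  rw [wienerNorm, tsum_eq_single k]
  · simp [fourierCoeff_fourier_eq]
  · intro n hn
    simp [fourierCoeff_fourier_eq, hn]

lemma wienerNorm_one : wienerNorm (1 : C(AddCircle T, ℂ)) = 1 := by
  rw [← wienerNorm_fourier (T := T) 0]
  congr 1
  ext x
  simp

lemma wienerNorm_mul_le {f : C(AddCircle T, ℂ)} (hf : wienerNorm f ≠ ⊤)
    (g : C(AddCircle T, ℂ)) : wienerNorm (f * g) ≤ wienerNorm f * wienerNorm g := by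
  have h := (hasSum_fourier_series_of_summable (summable_fourierCoeff hf)).mul_right g
  refine (wienerNorm_le_tsum h).trans_eq ?_
  simp only [smul_mul_assoc, wienerNorm_smul, wienerNorm_fourier_mul]
  rw [ENNReal.tsum_mul_right]
  rfl

lemma enorm_le_wienerNorm (f : C(AddCircle T, ℂ)) : ‖f‖ₑ ≤ wienerNorm f := by
  by_cases hf : wienerNorm f = ⊤
  · simp [hf]
  have h := hasSum_fourier_series_of_summable (summable_fourierCoeff hf)
  nth_rw 1 [← h.tsum_eq]
  refine enorm_tsum_le_tsum_enorm.trans_eq (tsum_congr fun n => ?_)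
  rw [enorm_smul, ← ofReal_norm (fourier n), fourier_norm, ENNReal.ofReal_one, mul_one]

lemma wienerNorm_pow_le {f : C(AddCircle T, ℂ)} (hf : wienerNorm f ≠ ⊤) (n : ℕ) :
    wienerNorm (f ^ n) ≤ wienerNorm f ^ n := by
  induction n with
  | zero => simp [wienerNorm_one]
  | succ n ih =>
    rw [pow_succ', pow_succ']
    exact (wienerNorm_mul_le hf _).trans (by gcongr)

lemma fourierCoeff_eq_zero_of_mem_trigPoly {N : ℕ} {q : C(AddCircle T, ℂ)}
    (hq : q ∈ trigPoly T N) {n : ℤ} (hn : n ∉ Set.Icc (-N : ℤ) N) : fourierCoeff q n = 0 := by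
  have h : trigPoly T N ≤ (fourierCoeffCLM n : C(AddCircle T, ℂ) →L[ℂ] ℂ).ker := by
    refine Submodule.span_le.2 ?_
    rintro _ ⟨k, hk, rfl⟩
    have : n ≠ k := fun h => hn (h ▸ hk)
    simp [fourierCoeff_fourier_eq, this]
  exact h hq

lemma wienerNorm_le_of_mem_trigPoly {N : ℕ} {q : C(AddCircle T, ℂ)} (hq : q ∈ trigPoly T N) :
    wienerNorm q ≤ (2 * N + 1) * ‖q‖ₑ := by
  rw [wienerNorm, tsum_eq_sum (s := Finset.Icc (-N : ℤ) N)]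
  · refine (Finset.sum_le_card_nsmul _ _ ‖q‖ₑ fun n _ => enorm_fourierCoeff_le n q).trans_eq ?_
    rw [Int.card_Icc, nsmul_eq_mul, show ((N : ℤ) + 1 - -N).toNat = 2 * N + 1 by omega]
    push_cast
    rfl
  · intro n hn
    rw [fourierCoeff_eq_zero_of_mem_trigPoly hq (by simpa using hn), enorm_zero]

lemma wienerNorm_ne_top_of_mem_trigPoly {N : ℕ} {q : C(AddCircle T, ℂ)}
    (hq : q ∈ trigPoly T N) : wienerNorm q ≠ ⊤ :=
  ne_top_of_le_ne_top (by finiteness) (wienerNorm_le_of_mem_trigPoly hq)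

lemma exists_trigPoly_wienerNorm_sub_lt {f : C(AddCircle T, ℂ)} (hf : wienerNorm f ≠ ⊤)
    {ε : ENNReal} (hε : 0 < ε) : ∃ N, ∃ q ∈ trigPoly T N, wienerNorm (f - q) < ε := by
  obtain ⟨s, hs⟩ := ((ENNReal.tendsto_tsum_compl_atTop_zero hf).eventually_lt_const hε).exists
  refine ⟨s.sup Int.natAbs, ∑ n ∈ s, fourierCoeff f n • fourier n,
    Submodule.sum_mem _ fun n hn => Submodule.smul_mem _ _ (fourier_mem_trigPoly ?_),
    lt_of_le_of_lt ?_ hs⟩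
  · have := Finset.le_sup (f := Int.natAbs) hn
    simp only [Set.mem_Icc]
    omega
  · have h := (s.hasSum_compl_iff).2 (by
      simpa using hasSum_fourier_series_of_summable (summable_fourierCoeff hf) :
        HasSum (fun n => fourierCoeff f n • fourier n) ((f - ∑ n ∈ s, fourierCoeff f n • fourier n)
          + ∑ n ∈ s, fourierCoeff f n • fourier n))
    refine (wienerNorm_le_tsum h).trans_eq (tsum_congr fun n => ?_)
    rw [wienerNorm_smul, wienerNorm_fourier, mul_one]

lemma exists_trigPoly_norm_sub_lt (f : C(AddCircle T, ℂ)) {ε : ℝ} (hε : 0 < ε) :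
    ∃ N, ∃ q ∈ trigPoly T N, ‖f - q‖ < ε := by
  have hf : f ∈ (Submodule.span ℂ (Set.range (@fourier T))).topologicalClosure := by
    rw [span_fourier_closure_eq_top]; trivial
  obtain ⟨q, hq, hfq⟩ := Metric.mem_closure_iff.1 hf ε hε
  rw [dist_eq_norm] at hfq
  suffices ∃ N, q ∈ trigPoly T N from this.imp fun N hN => ⟨q, hN, hfq⟩
  have hle : Submodule.span ℂ (Set.range (@fourier T)) ≤ ⨆ N, trigPoly T N := by
    refine Submodule.span_le.2 ?_
    rintro _ ⟨n, rfl⟩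
    refine Submodule.mem_iSup_of_mem n.natAbs (fourier_mem_trigPoly ?_)
    simp only [Set.mem_Icc]
    omega
  have hmono : Monotone (trigPoly T) := fun M N h => Submodule.span_mono
    (Set.image_mono (Set.Icc_subset_Icc (by simpa using h) (by simpa using h)))
  exact (Submodule.mem_iSup_of_directed _ hmono.directed_le).1 (hle hq)

/-- Powers of an element of the Wiener algebra with uniform norm less than one are summable. -/
lemma tsum_wienerNorm_pow_ne_top {u : C(AddCircle T, ℂ)} (hu : wienerNorm u ≠ ⊤)
    (h1 : ‖u‖ < 1) : ∑' n : ℕ, wienerNorm (u ^ n) ≠ ⊤ := by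
  obtain ⟨ε, hε, hεu⟩ : ∃ ε : ENNReal, 0 < ε ∧ ‖u‖ₑ + (ε + ε) < 1 := by
    refine ⟨ENNReal.ofReal ((1 - ‖u‖) / 4), by simpa using h1, ?_⟩
    rw [← ofReal_norm, ← ENNReal.ofReal_add (by linarith) (by linarith),
      ← ENNReal.ofReal_add (norm_nonneg u) (by linarith), ENNReal.ofReal_lt_one]
    linarith
  obtain ⟨N, q, hq, hqε⟩ := exists_trigPoly_wienerNorm_sub_lt hu hε
  set v := u - q with hv
  have hvt : wienerNorm v ≠ ⊤ := hqε.ne_top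
  set ρ := ‖q‖ₑ + wienerNorm v with hρ
  have hρ1 : ρ < 1 := by
    have : q = u - v := by simp [hv]
    refine lt_of_le_of_lt ?_ hεu
    rw [hρ, ← add_assoc]
    gcongr
    rw [this]
    exact (enorm_sub_le).trans (by gcongr; exact (enorm_le_wienerNorm v).trans hqε.le)
  have key (n : ℕ) : wienerNorm (u ^ n) ≤ (2 * (n * N) + 1) * ρ ^ n := by
    have hun : u = q + v := by simp [hv]
    rw [hun, add_pow, hρ, add_pow, Finset.mul_sum]
    refine (Finset.le_sum_of_subadditive wienerNorm (by simp [wienerNorm, fourierCoeff])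
      wienerNorm_add_le _ _).trans (Finset.sum_le_sum fun j hj => ?_)
    have hqj := pow_mem_trigPoly hq j
    have hjn : j ≤ n := by simpa [Nat.lt_succ_iff] using hj
    rw [← nsmul_eq_mul', ← Nat.cast_smul_eq_nsmul ℂ, wienerNorm_smul]
    have hc : ‖((n.choose j : ℕ) : ℂ)‖ₑ = n.choose j := by
      rw [← ofReal_norm, Complex.norm_natCast, ENNReal.ofReal_natCast]
    rw [hc]
    calc _ ≤ (n.choose j : ENNReal) *
            ((2 * (j * N : ℕ) + 1) * ‖q ^ j‖ₑ * wienerNorm v ^ (n - j)) := by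
          gcongr
          refine (wienerNorm_mul_le (wienerNorm_ne_top_of_mem_trigPoly hqj) _).trans ?_
          gcongr
          · exact wienerNorm_le_of_mem_trigPoly hqj
          · exact wienerNorm_pow_le hvt _
      _ ≤ (n.choose j : ENNReal) * ((2 * (n * N : ℕ) + 1) * ‖q‖ₑ ^ j * wienerNorm v ^ (n - j)) := by
          gcongr
          rw [← ofReal_norm, ← ofReal_norm, ← ENNReal.ofReal_pow (norm_nonneg q)]
          exact ENNReal.ofReal_le_ofReal (norm_pow_le q j)
      _ = _ := by push_cast; ring
  refine ne_top_of_le_ne_top ?_ (ENNReal.tsum_le_tsum key)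
  clear_value ρ
  lift ρ to NNReal using hρ1.ne_top
  have hρ2 : ‖(ρ : ℝ)‖ < 1 := by simpa using hρ1
  have hsum : Summable fun n : ℕ => ((2 * (n * N) + 1) * ρ ^ n : NNReal) := by
    rw [← NNReal.summable_coe]
    refine (((summable_pow_mul_geometric_of_norm_lt_one 1 hρ2).mul_left (2 * N : ℝ)).add
      (summable_geometric_of_norm_lt_one hρ2)).congr fun n => ?_
    push_cast
    ring
  exact_mod_cast ENNReal.tsum_coe_ne_top_iff_summable.2 hsum

lemma exists_hasSum_mul_pow {u : C(AddCircle T, ℂ)} {c : ℕ → ℂ}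
    (h : ∑' n, ‖c n‖ₑ * wienerNorm (u ^ n) ≠ ⊤) :
    ∃ L : C(AddCircle T, ℂ), wienerNorm L ≠ ⊤ ∧ ∀ x, HasSum (fun n => c n * u x ^ n) (L x) := by
  have hs : Summable fun n => c n • u ^ n := by
    refine .of_enorm (ne_top_of_le_ne_top h (ENNReal.tsum_le_tsum fun n => ?_))
    rw [← wienerNorm_smul]
    exact enorm_le_wienerNorm _
  refine ⟨_, ne_top_of_le_ne_top h ?_, fun x => (ContinuousMap.evalCLM ℂ x).hasSum hs.hasSum⟩
  simpa only [wienerNorm_smul] using wienerNorm_le_tsum hs.hasSum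

lemma exists_wienerNorm_ne_top_exp {p : C(AddCircle T, ℂ)} (hp : wienerNorm p ≠ ⊤) :
    ∃ E : C(AddCircle T, ℂ), wienerNorm E ≠ ⊤ ∧ ∀ x, E x = Complex.exp (p x) := by
  have hsum : ∑' n : ℕ, ‖((n.factorial : ℂ)⁻¹)‖ₑ * wienerNorm (p ^ n) ≠ ⊤ := by
    refine ne_top_of_le_ne_top ?_
      (ENNReal.tsum_le_tsum fun n => mul_le_mul_right (wienerNorm_pow_le hp n) _)
    lift wienerNorm p to NNReal using hp with r
    have hs : Summable fun n : ℕ => ‖((n.factorial : ℂ)⁻¹)‖₊ * r ^ n := by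
      rw [← NNReal.summable_coe]
      refine (Real.summable_pow_div_factorial r).congr fun n => ?_
      simp [div_eq_inv_mul]
    exact_mod_cast ENNReal.tsum_coe_ne_top_iff_summable.2 hs
  obtain ⟨E, hE, hEx⟩ := exists_hasSum_mul_pow hsum
  refine ⟨E, hE, fun x => (hEx x).unique ?_⟩
  rw [Complex.exp_eq_exp_ℂ]
  simpa using NormedSpace.exp_series_hasSum_exp' (𝕂 := ℂ) (p x)

/-- **Wiener–Lévy theorem** for the logarithm: a continuous logarithm of an element of the Wiener
algebra belongs to the Wiener algebra. -/
theorem wienerNorm_ne_top_of_exp_eq {F G : C(AddCircle T, ℂ)} (hF : wienerNorm F ≠ ⊤)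
    (h : ∀ x, Complex.exp (G x) = F x) : wienerNorm G ≠ ⊤ := by
  obtain ⟨N, p, hpN, hGp⟩ := exists_trigPoly_norm_sub_lt G (show (0 : ℝ) < 1 / 4 by norm_num)
  have hp := wienerNorm_ne_top_of_mem_trigPoly hpN
  obtain ⟨E, hE, hEx⟩ := exists_wienerNorm_ne_top_exp (p := (-1 : ℂ) • p) (by
    rw [wienerNorm_smul]; finiteness)
  set u : C(AddCircle T, ℂ) := F * E + (-1 : ℂ) • 1 with hu
  have hux (x) : 1 + u x = Complex.exp (G x - p x) := by
    simp [hu, hEx, ← h, sub_eq_add_neg, Complex.exp_add]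
  have hle (x) : ‖G x - p x‖ < 1 / 4 := ((G - p).norm_coe_le_norm x).trans_lt hGp
  have hu1 : ‖u‖ ≤ 1 / 2 := by
    refine (ContinuousMap.norm_le _ (by norm_num)).2 fun x => ?_
    rw [← add_sub_cancel_left 1 (u x), hux]
    have := Complex.norm_exp_sub_one_le (x := G x - p x) (by linarith [hle x])
    linarith [hle x]
  have hut : wienerNorm u ≠ ⊤ := by
    refine ne_top_of_le_ne_top ?_ (wienerNorm_add_le _ _)
    rw [wienerNorm_smul, wienerNorm_one]
    have := ne_top_of_le_ne_top (ENNReal.mul_ne_top hF hE) (wienerNorm_mul_le hF E)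
    finiteness
  obtain ⟨L, hL, hLx⟩ := exists_hasSum_mul_pow (u := u) (c := fun n => (-1) ^ (n + 1) / n)
    (ne_top_of_le_ne_top (tsum_wienerNorm_pow_ne_top hut (by linarith))
      (ENNReal.tsum_le_tsum fun n => mul_le_of_le_one_left' (by
        rw [← ofReal_norm, ENNReal.ofReal_le_one]
        rcases n.eq_zero_or_pos with rfl | hn
        · simp
        · simpa using inv_le_one_of_one_le₀ (Nat.one_le_cast.2 hn))))
  have hGL : G = L + p := by
    ext x
    have hx : ‖u x‖ < 1 := by linarith [u.norm_coe_le_norm x]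
    have := (hLx x).unique ((hasSum_taylorSeries_log hx).congr_fun fun n => by ring)
    have him := (Complex.abs_im_le_norm (G x - p x)).trans_lt (hle x)
    have hpi := Real.pi_gt_three
    rw [ContinuousMap.add_apply, this, hux, Complex.log_exp, sub_add_cancel] <;>
      linarith [abs_lt.1 him]
  rw [hGL]
  exact ne_top_of_le_ne_top (by finiteness) (wienerNorm_add_le _ _)

end WienerAlgebra

instance factTwoPiPos : Fact (0 < 2 * Real.pi) := ⟨Real.two_pi_pos⟩

lemma fourier_two_pi (n : ℤ) (z : ℝ) :
    fourier n (z : AddCircle (2 * Real.pi)) = Complex.exp (Complex.I * n * z) := by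
  rw [fourier_coe_apply]
  congr 1
  have : (Real.pi : ℂ) ≠ 0 := by exact_mod_cast Real.pi_ne_zero
  push_cast
  field_simp

lemma exists_continuousMap_addCircle {T : ℝ} {f : ℝ → ℂ} (hf : Continuous f)
    (hp : Function.Periodic f T) : ∃ F : C(AddCircle T, ℂ), ∀ x : ℝ, F x = f x :=
  ⟨⟨hp.lift, hf.quotient_liftOn' _⟩, fun x => hp.lift_coe x⟩

/-- Two continuous logarithms of the same function on `ℝ` differ by a constant in `2πiℤ`. -/
lemma exists_int_eq_add_of_exp_eq {g₁ g₂ : ℝ → ℂ} (h₁ : Continuous g₁) (h₂ : Continuous g₂)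
    (h : ∀ z, Complex.exp (g₁ z) = Complex.exp (g₂ z)) :
    ∃ k : ℤ, ∀ z, g₁ z = g₂ z + k * (2 * Real.pi * Complex.I) := by
  choose m hm using fun z => Complex.exp_eq_exp_iff_exists_int.1 (h z)
  have hmc : Continuous m := by
    rw [Int.isClosedEmbedding_coe_real.isInducing.continuous_iff]
    have : (Int.cast ∘ m : ℝ → ℝ) = fun z => ((g₁ z - g₂ z) / (2 * Real.pi * Complex.I)).re := by
      ext z
      rw [hm z, add_sub_cancel_left, mul_div_cancel_right₀ _ Complex.two_pi_I_ne_zero]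
      simp
    rw [this]
    fun_prop
  exact ⟨m 0, fun z => by
    rw [hm z, PreconnectedSpace.constant inferInstance hmc (x := z) (y := 0)]⟩

lemma exists_continuous_log {f : ℝ → ℂ} (hf : Continuous f) (h0 : f 0 = 1) (hne : ∀ z, f z ≠ 0) :
    ∃ g : ℝ → ℂ, Continuous g ∧ g 0 = 0 ∧ ∀ z, Complex.exp (g z) = f z := by
  obtain ⟨g, ⟨hg0, hg⟩, -⟩ := Complex.isCoveringMapOn_exp.existsUnique_continuousMap_lifts
    ⟨f, hf⟩ (a₀ := 0) (e₀ := 0) (by simp [h0]) (by simpa using hne)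
  exact ⟨g, g.continuous, hg0, congrFun hg⟩

lemma integral_exp_mul_id {n : ℤ} (hn : n ≠ 0) :
    ∫ z in (0 : ℝ)..(2 * Real.pi), Complex.exp (-(Complex.I * n * z)) * (z : ℂ) =
      2 * Real.pi * Complex.I / n := by
  have hn' : (n : ℂ) ≠ 0 := by exact_mod_cast hn
  have hderiv (x : ℝ) : HasDerivAt
      (fun z : ℝ => Complex.exp (-(Complex.I * n * z)) * (Complex.I * z / n + 1 / n ^ 2))
      (Complex.exp (-(Complex.I * n * x)) * (x : ℂ)) x := by
    have hid : HasDerivAt (fun z : ℝ => (z : ℂ)) 1 x := Complex.ofRealCLM.hasDerivAt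
    convert! ((hid.const_mul (Complex.I * n)).neg.cexp).mul
      (((hid.const_mul Complex.I).div_const (n : ℂ)).add_const (1 / (n : ℂ) ^ 2)) using 1
    field_simp
    linear_combination (x * n * Complex.exp (-(Complex.I * n * x)) : ℂ) * Complex.I_sq
  rw [intervalIntegral.integral_eq_sub_of_hasDerivAt (fun x _ => hderiv x)
    (Continuous.intervalIntegrable (by fun_prop) _ _)]
  have hper : Complex.exp (-(Complex.I * n * (2 * Real.pi : ℝ))) = 1 := by
    rw [Complex.exp_eq_one_iff]
    exact ⟨-n, by push_cast; ring⟩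
  rw [hper]
  simp
  ring

lemma conj_charFn (μ : Measure ℝ) (z : ℝ) : (starRingEnd ℂ) (charFn μ z) = charFn μ (-z) := by
  rw [charFn, charFn, ← integral_conj]
  refine integral_congr_ae (Eventually.of_forall fun x => ?_)
  simp [← Complex.exp_conj]

section CharFn

variable {μ : Measure ℝ} [IsProbabilityMeasure μ]

lemma charFn_zero : charFn μ 0 = 1 := by simp [charFn]

lemma hasSum_charFn (hsupp : μ (Set.range ((↑) : ℤ → ℝ))ᶜ = 0) (z : ℝ) :
    HasSum (fun n : ℤ => (μ.real {(n : ℝ)} : ℂ) * Complex.exp (Complex.I * n * z))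
      (charFn μ z) := by
  have hintegrable : Integrable (fun x : ℝ => Complex.exp (Complex.I * z * x)) μ := by
    refine .of_bound (by fun_prop) 1 (Eventually.of_forall fun x => ?_)
    rw [mul_assoc, mul_comm, ← Complex.ofReal_mul, Complex.norm_exp_ofReal_mul_I]
  have h := hasSum_integral_iUnion (s := fun n : ℤ => {(n : ℝ)})
    (fun n => measurableSet_singleton _)
    (fun m n hmn => by simpa using fun h => hmn (by exact_mod_cast h)) hintegrable.integrableOn
  rw [Set.iUnion_singleton_eq_range, Measure.restrict_eq_self_of_ae_mem
    (by exact mem_ae_iff.2 hsupp)] at h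
  refine h.congr_fun fun n => ?_
  rw [integral_singleton, Complex.real_smul]
  push_cast
  ring_nf

/-- The characteristic function of a lattice distribution is an element of the Wiener algebra. -/
lemma exists_wienerNorm_ne_top_charFn (hsupp : μ (Set.range ((↑) : ℤ → ℝ))ᶜ = 0) :
    ∃ F : C(AddCircle (2 * Real.pi), ℂ), wienerNorm F ≠ ⊤ ∧ ∀ z : ℝ, F z = charFn μ z := by
  set f : ℤ → C(AddCircle (2 * Real.pi), ℂ) := fun n => (μ.real {(n : ℝ)} : ℂ) • fourier n
  have hf (n : ℤ) : wienerNorm (f n) = μ {(n : ℝ)} := by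
    rw [wienerNorm_smul, wienerNorm_fourier, mul_one, ← ofReal_norm, Complex.norm_real,
      Real.norm_of_nonneg measureReal_nonneg, ofReal_measureReal]
  have htop : ∑' n, wienerNorm (f n) ≠ ⊤ := by
    simp only [hf]
    rw [← measure_iUnion (fun m n hmn => by simpa using fun h => hmn (by exact_mod_cast h))
      (fun n => measurableSet_singleton _)]
    finiteness
  have hs : Summable f :=
    .of_enorm (ne_top_of_le_ne_top htop (ENNReal.tsum_le_tsum fun n => enorm_le_wienerNorm _))
  refine ⟨_, ne_top_of_le_ne_top htop (wienerNorm_le_tsum hs.hasSum), fun z => ?_⟩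
  refine ((ContinuousMap.evalCLM ℂ (z : AddCircle (2 * Real.pi))).hasSum hs.hasSum).unique ?_
  refine (hasSum_charFn hsupp z).congr_fun fun n => ?_
  rw [← fourier_two_pi]
  rfl

/-- The Lévy–Khintchine representation obtained from the distinguished logarithm. -/
lemma exists_lattice_levyKhintchine (hsupp : μ (Set.range ((↑) : ℤ → ℝ))ᶜ = 0) {g : ℝ → ℂ}
    (hg : Continuous g) (hg0 : g 0 = 0) (hexp : ∀ z : ℝ, Complex.exp (g z) = charFn μ z) :
    ∃ k : ℤ, ∃ b : ℤ → ℝ, Summable b ∧ b 0 = 0 ∧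
      (k : ℂ) = g (2 * Real.pi) / (2 * Real.pi * Complex.I) ∧
      (∀ n : ℤ, n ≠ 0 → (b n : ℂ) = (k : ℂ) / (n : ℂ) +
        (1 / (2 * Real.pi : ℝ)) *
          ∫ z in (0 : ℝ)..(2 * Real.pi), Complex.exp (-(Complex.I * n * z)) * g z) ∧
      ∀ z : ℝ, charFn μ z = Complex.exp (Complex.I * k * z +
        ∑' n : ℤ, (b n : ℂ) * (Complex.exp (Complex.I * n * z) - 1)) := by
  obtain ⟨F, hF, hFz⟩ := exists_wienerNorm_ne_top_charFn hsupp
  obtain ⟨k, hk⟩ := exists_int_eq_add_of_exp_eq (g₁ := fun z => g (z + 2 * Real.pi)) (g₂ := g)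
    (by fun_prop) hg fun z => by
      rw [hexp, hexp, ← hFz, ← hFz, AddCircle.coe_add_period]
  have hgk : g (2 * Real.pi) = k * (2 * Real.pi * Complex.I) := by
    simpa [hg0] using hk 0
  obtain ⟨m, hm⟩ := exists_int_eq_add_of_exp_eq
    (g₁ := fun z => (starRingEnd ℂ) (g (-z))) (g₂ := g)
    (Complex.continuous_conj.comp (hg.comp continuous_neg)) hg fun z => by
      rw [Complex.exp_conj, hexp, hexp, conj_charFn, neg_neg]
  have hm0 : m * (2 * Real.pi * Complex.I) = 0 := by simpa [hg0] using (hm 0).symm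
  obtain ⟨G, hG⟩ := exists_continuousMap_addCircle (T := 2 * Real.pi)
    (f := fun z => g z - Complex.I * k * z) (by fun_prop) fun z => by
      simp only [hk z]
      push_cast
      ring
  have hGt : wienerNorm G ≠ ⊤ := by
    refine wienerNorm_ne_top_of_exp_eq (F := fourier (-k) * F)
      (by rwa [wienerNorm_fourier_mul]) fun x => ?_
    induction x using QuotientAddGroup.induction_on with
    | H z =>
      rw [hG, ContinuousMap.mul_apply, hFz, ← hexp, fourier_two_pi, ← Complex.exp_add]
      congr 1
      push_cast
      ring
  have hsum := summable_fourierCoeff hGt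
  have hconj (x : AddCircle (2 * Real.pi)) : (starRingEnd ℂ) (G x) = G (-x) := by
    induction x using QuotientAddGroup.induction_on with
    | H z =>
      rw [← AddCircle.coe_neg, hG, hG]
      have := hm (-z)
      rw [hm0, add_zero, neg_neg] at this
      simp [this]
  have hreal (n : ℤ) : ((fourierCoeff G n).re : ℂ) = fourierCoeff G n := by
    refine Complex.conj_eq_iff_re.1 ?_
    rw [fourierCoeff, ← integral_conj, ← integral_neg_eq_self]
    refine integral_congr_ae (Eventually.of_forall fun x => ?_)
    simp only [smul_eq_mul, map_mul, hconj, neg_neg, ← fourier_neg]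
    congr 1
    simp [fourier_apply]
  have hb (n : ℤ) (z : ℝ) : ((if n = 0 then 0 else (fourierCoeff G n).re : ℝ) : ℂ) *
      (Complex.exp (Complex.I * n * z) - 1) =
      fourierCoeff G n * Complex.exp (Complex.I * n * z) - fourierCoeff G n := by
    split_ifs with h
    · simp [h]
    · rw [hreal]; ring
  have hsumz (z : ℝ) :
      HasSum (fun n => fourierCoeff G n * Complex.exp (Complex.I * n * z)) (G z) := by
    simpa only [fourier_two_pi, smul_eq_mul] using
      has_pointwise_sum_fourier_series_of_summable hsum z
  refine ⟨k, fun n => if n = 0 then 0 else (fourierCoeff G n).re, ?_, by simp, ?_, ?_, ?_⟩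
  · refine .of_norm_bounded hsum.norm fun n => ?_
    split_ifs
    · simp
    · exact Complex.abs_re_le_norm _
  · rw [hgk, mul_div_cancel_right₀ _ Complex.two_pi_I_ne_zero]
  · intro n hn
    have hn' : (n : ℂ) ≠ 0 := by exact_mod_cast hn
    have hpi : (Real.pi : ℂ) ≠ 0 := by exact_mod_cast Real.pi_ne_zero
    have hsplit : ∫ z in (0 : ℝ)..(2 * Real.pi),
        fourier (-n) (z : AddCircle (2 * Real.pi)) • G z =
        (∫ z in (0 : ℝ)..(2 * Real.pi), Complex.exp (-(Complex.I * n * z)) * g z) -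
          Complex.I * k * (2 * Real.pi * Complex.I / n) := by
      rw [← integral_exp_mul_id hn, ← intervalIntegral.integral_const_mul,
        ← intervalIntegral.integral_sub (Continuous.intervalIntegrable (by fun_prop) _ _)
          (Continuous.intervalIntegrable (by fun_prop) _ _)]
      refine intervalIntegral.integral_congr fun z _ => ?_
      simp only [hG, fourier_two_pi, smul_eq_mul]
      push_cast
      ring_nf
    simp only [if_neg hn]
    rw [hreal, fourierCoeff_eq_intervalIntegral G n 0, zero_add, hsplit,
      Complex.real_smul]
    push_cast
    field_simp
    linear_combination (-2 * Real.pi * k : ℂ) * Complex.I_sq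
  · intro z
    have h0 : HasSum (fourierCoeff G) 0 := by
      have := hsumz 0
      rw [hG] at this
      simpa [hg0] using this
    simp only [hb]
    rw [((hsumz z).sub h0).tsum_eq, hG, ← hexp]
    congr 1
    ring

end CharFn

lemma gKer_intCast (c : ℝ → ℝ) {n : ℤ} (hn : n ≠ 0) (z : ℝ) :
    gKer c n z = Complex.exp (Complex.I * n * z) - 1 - Complex.I * z * c n := by
  have h1 : (1 : ℝ) ≤ (n : ℝ) ^ 2 := by
    have : 0 < n ^ 2 := by positivity
    exact_mod_cast Int.add_one_le_of_lt this
  rw [gKer, if_neg (by exact_mod_cast hn), min_eq_left h1]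
  push_cast
  ring_nf

lemma norm_gKer_intCast_le {c : ℝ → ℝ} {M : ℝ} (hM : ∀ x, |c x| ≤ M) (n : ℤ) (z : ℝ) :
    ‖gKer c n z‖ ≤ z ^ 2 / 2 + (2 + |z| * M) := by
  have hM0 : 0 ≤ M := (abs_nonneg _).trans (hM 0)
  rcases eq_or_ne n 0 with rfl | hn
  · have : 0 ≤ 2 + |z| * M := by positivity
    simpa [gKer] using this
  · rw [gKer_intCast c hn]
    have h1 : ‖Complex.exp (Complex.I * n * z)‖ = 1 := by
      have : Complex.I * n * z = ((n * z : ℝ) : ℂ) * Complex.I := by push_cast; ring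
      rw [this, Complex.norm_exp_ofReal_mul_I]
    have h2 : ‖Complex.I * z * c n‖ ≤ |z| * M := by
      simpa using mul_le_mul_of_nonneg_left (hM n) (abs_nonneg z)
    have h3 := norm_sub_le (Complex.exp (Complex.I * n * z) - 1) (Complex.I * z * c n)
    have h4 := norm_sub_le (Complex.exp (Complex.I * n * z)) 1
    rw [h1, norm_one] at h4
    linarith [sq_nonneg z]

/-- The measure on `ℝ` giving each integer `n` the mass `max (b n) 0`. -/
def latticeMeasure (b : ℤ → ℝ) : Measure ℝ :=
  (Measure.sum fun n : ℤ => ENNReal.ofReal (b n) • Measure.dirac n).map ((↑) : ℤ → ℝ)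

lemma measurableEmbedding_intCast_real : MeasurableEmbedding ((↑) : ℤ → ℝ) :=
  Int.isClosedEmbedding_coe_real.measurableEmbedding

lemma isFiniteMeasure_sum_ofReal_smul_dirac {b : ℤ → ℝ} (hb : Summable b) :
    IsFiniteMeasure (Measure.sum fun n : ℤ => ENNReal.ofReal (b n) • Measure.dirac n) :=
  ⟨by simpa [Measure.sum_apply] using hb.tsum_ofReal_lt_top⟩

lemma isFiniteMeasure_latticeMeasure {b : ℤ → ℝ} (hb : Summable b) :
    IsFiniteMeasure (latticeMeasure b) :=
  have := isFiniteMeasure_sum_ofReal_smul_dirac hb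
  Measure.isFiniteMeasure_map _ _

lemma integral_latticeMeasure {b : ℤ → ℝ} (hb : Summable b) {f : ℝ → ℂ} {C : ℝ}
    (hf : ∀ n : ℤ, ‖f n‖ ≤ C) :
    ∫ x, f x ∂(latticeMeasure b) = ∑' n : ℤ, (max (b n) 0 : ℝ) * f n := by
  have := isFiniteMeasure_sum_ofReal_smul_dirac hb
  rw [latticeMeasure, measurableEmbedding_intCast_real.integral_map,
    integral_countable (.of_bound .of_discrete C (Eventually.of_forall hf))]
  refine tsum_congr fun n => ?_
  rw [Measure.real, Measure.sum_smul_dirac_singleton, ENNReal.toReal_ofReal', Complex.real_smul]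

lemma mutuallySingular_latticeMeasure_neg (b : ℤ → ℝ) :
    Measure.MutuallySingular (latticeMeasure b) (latticeMeasure (-b)) := by
  have hemb := measurableEmbedding_intCast_real
  refine ⟨(↑) '' {n : ℤ | b n ≤ 0}, hemb.measurableSet_image.2 .of_discrete, ?_, ?_⟩
  · rw [latticeMeasure, hemb.map_apply, Set.preimage_image_eq _ Int.cast_injective,
      Measure.sum_apply _ .of_discrete, ENNReal.tsum_eq_zero]
    intro n
    by_cases h : b n ≤ 0 <;> simp [h]
  · rw [latticeMeasure, hemb.map_apply, Set.preimage_compl,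
      Set.preimage_image_eq _ Int.cast_injective,
      Measure.sum_apply _ .of_discrete, ENNReal.tsum_eq_zero]
    intro n
    rcases le_or_gt (b n) 0 with h | h
    · simp [h]
    · simp [h.le]

lemma isQID_of_lattice_levyKhintchine {c : ℝ → ℝ} (hc : IsRepFn c) {μ : Measure ℝ} {k : ℤ}
    {b : ℤ → ℝ} (hb : Summable b) (hb0 : b 0 = 0)
    (h : ∀ z : ℝ, charFn μ z = Complex.exp (Complex.I * k * z +
      ∑' n : ℤ, (b n : ℂ) * (Complex.exp (Complex.I * n * z) - 1))) : IsQID c μ := by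
  obtain ⟨-, ⟨M, hM⟩, -⟩ := hc
  have hbc : Summable fun n : ℤ => b n * c n :=
    .of_norm_bounded (hb.norm.mul_right M) fun n => by
      rw [norm_mul]
      exact mul_le_mul_of_nonneg_left (hM n) (norm_nonneg _)
  have hmul {a : ℤ → ℝ} (ha : Summable a) (z : ℝ) :
      Summable fun n : ℤ => (a n : ℂ) * gKer c n z :=
    .of_norm_bounded (ha.norm.mul_right _) fun n => by
      rw [norm_mul, Complex.norm_real]
      exact mul_le_mul_of_nonneg_left (norm_gKer_intCast_le hM n z) (norm_nonneg _)
  have hmax {a : ℤ → ℝ} (ha : Summable a) : Summable fun n => max (a n) 0 :=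
    .of_norm_bounded ha.norm fun n => by
      rw [Real.norm_of_nonneg (le_max_right _ _)]
      exact max_le (Real.le_norm_self _) (norm_nonneg _)
  have hneg : Summable (-b) := hb.neg
  refine ⟨k + ∑' n : ℤ, b n * c n, latticeMeasure b, latticeMeasure (-b),
    isFiniteMeasure_latticeMeasure hb, isFiniteMeasure_latticeMeasure hneg,
    mutuallySingular_latticeMeasure_neg b, fun z => ?_⟩
  have hbz : Summable fun n : ℤ => (b n : ℂ) * gKer c n z := hmul hb z
  have hterm (n : ℤ) : (b n : ℂ) * (Complex.exp (Complex.I * n * z) - 1) =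
      b n * gKer c n z + Complex.I * z * ((b n * c n : ℝ) : ℂ) := by
    rcases eq_or_ne n 0 with rfl | hn
    · simp [hb0]
    · rw [gKer_intCast c hn]
      push_cast
      ring
  rw [h, integral_latticeMeasure hb (norm_gKer_intCast_le hM · z),
    integral_latticeMeasure hneg (norm_gKer_intCast_le hM · z), add_sub_assoc,
    ← (hmul (hmax hb) z).tsum_sub (hmul (hmax hneg) z)]
  simp only [hterm]
  rw [hbz.tsum_add ((Complex.summable_ofReal.2 hbc).mul_left _), tsum_mul_left,
    ← Complex.ofReal_tsum]
  have hpm (n : ℤ) : ((max (b n) 0 : ℝ) : ℂ) * gKer c n z -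
      ((max ((-b) n) 0 : ℝ) : ℂ) * gKer c n z = b n * gKer c n z := by
    rw [← sub_mul, ← Complex.ofReal_sub, Pi.neg_apply, max_zero_sub_max_neg_zero_eq_self]
  simp only [hpm]
  congr 1
  push_cast
  ring

/-- a distribution concentrated on ℤ is quasi-infinitely divisible
iff its characteristic function has no zeroes; in that case the Gaussian variance
is 0, the quasi-Lévy measure ν is a finite signed measure concentrated on ℤ∖{0},
the drift is k = (2πi)⁻¹ g(2π) ∈ ℤ for the distinguished logarithm g of μ̂, and
ν({n}) is the n-th Fourier coefficient of g(z) - ikz. -/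
theorem stmt18 (c : ℝ → ℝ) (hc : IsRepFn c) (μ : Measure ℝ) [IsProbabilityMeasure μ]
    (hsupp : μ (Set.range ((↑) : ℤ → ℝ))ᶜ = 0) :
    (IsQID c μ ↔ ∀ z : ℝ, charFn μ z ≠ 0) ∧
    ((∀ z : ℝ, charFn μ z ≠ 0) →
      ∀ g : ℝ → ℂ, Continuous g → g 0 = 0 → (∀ z : ℝ, Complex.exp (g z) = charFn μ z) →
      ∃ k : ℤ, ∃ b : ℤ → ℝ, Summable b ∧ b 0 = 0 ∧
        (k : ℂ) = g (2 * Real.pi) / (2 * Real.pi * Complex.I) ∧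
        (∀ n : ℤ, n ≠ 0 → (b n : ℂ) = (k : ℂ) / (n : ℂ) +
          (1 / (2 * Real.pi : ℝ)) *
            ∫ z in (0 : ℝ)..(2 * Real.pi), Complex.exp (-(Complex.I * n * z)) * g z) ∧
        ∀ z : ℝ, charFn μ z = Complex.exp (Complex.I * k * z +
          ∑' n : ℤ, (b n : ℂ) * (Complex.exp (Complex.I * n * z) - 1))) := by
  have key : (∀ z : ℝ, charFn μ z ≠ 0) → IsQID c μ := fun hne => by
    obtain ⟨F, -, hF⟩ := exists_wienerNorm_ne_top_charFn hsupp
    have hcont : Continuous (charFn μ) :=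
      (F.continuous.comp (AddCircle.continuous_mk' _)).congr hF
    obtain ⟨g, hg, hg0, hexp⟩ := exists_continuous_log hcont charFn_zero hne
    obtain ⟨k, b, hb, hb0, -, -, h⟩ := exists_lattice_levyKhintchine hsupp hg hg0 hexp
    exact isQID_of_lattice_levyKhintchine hc hb hb0 h
  refine ⟨⟨?_, key⟩, fun _ g hg hg0 hexp => exists_lattice_levyKhintchine hsupp hg hg0 hexp⟩
  rintro ⟨γ, ζp, ζm, -, -, -, h⟩ z
  rw [h]
  exact Complex.exp_ne_zero _
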